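/- For every integer k ≥ 0, there exists d_k in (c_k, π/2) such that cos d_k = |T_{4k+2}(d_k)|, where c_k is the unique zero of T_{4k+2} in (0, π/2). -/

import Mathlib

theorem T_lt_zero (k : ℕ) :
    (∑ i ∈ Finset.range (2 * k + 2), (-1 : ℝ) ^ i * (Real.pi / 2) ^ (2 * i) / (Nat.factorial (2 * i))) < 0 := by
  have hx0 : 0 < Real.pi / 2 := by positivity
  have hx2 : Real.pi / 2 < 2 := by linarith [Real.pi_lt_four]
  have hcos := Real.hasSum_cos (Real.pi / 2)
  rw [Real.cos_pi_div_two] at hcos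
  generalize Real.pi / 2 = x at *
  let a : ℕ → ℝ := fun i => x ^ (2 * (i + 1)) / (Nat.factorial (2 * (i + 1)))
  have hsum : ∀ n, (∑ i ∈ Finset.range (n + 1), (-1 : ℝ) ^ i * x ^ (2 * i) / (Nat.factorial (2 * i)))
      = 1 - ∑ i ∈ Finset.range n, (-1 : ℝ) ^ i * a i := by
    intro n
    rw [Finset.sum_range_succ', sub_eq_neg_add, ← Finset.sum_neg_distrib]
    congr 1
    · refine Finset.sum_congr rfl fun i _ => ?_
      simp only [a]
      ring
    · simp
  have hlt : ∀ i, a (i + 1) < a i := by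
    intro i
    have h1 : a (i + 1) = a i * (x ^ 2 / ((2 * i + 3) * (2 * i + 4))) := by
      simp only [a]
      rw [show 2 * (i + 1 + 1) = 2 * (i + 1) + 1 + 1 by ring, Nat.factorial_succ, Nat.factorial_succ]
      have : ((2 * (i + 1)).factorial : ℝ) ≠ 0 := by positivity
      push_cast
      have h3 : (2 * (i : ℝ) + 3) ≠ 0 := by positivity
      have h4 : (2 * (i : ℝ) + 4) ≠ 0 := by positivity
      rw [show 2 * ((i : ℝ) + 1) + 1 + 1 = 2 * i + 4 by ring,
        show 2 * ((i : ℝ) + 1) + 1 = 2 * i + 3 by ring]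
      field_simp
      ring
    have h2 : 0 < a i := by simp only [a]; positivity
    rw [h1]
    apply mul_lt_of_lt_one_right h2
    rw [div_lt_one (by positivity)]
    have : (0 : ℝ) ≤ i := by positivity
    nlinarith
  have hanti : Antitone a := antitone_nat_of_succ_le fun i => (hlt i).le
  have ht : Filter.Tendsto (fun n => ∑ i ∈ Finset.range n, (-1 : ℝ) ^ i * a i) Filter.atTop (nhds 1) := by
    have h := (Filter.tendsto_add_atTop_iff_nat 1).2 hcos.tendsto_sum_nat
    simp only [hsum] at h
    have h' := h.const_sub 1
    simpa using h'
  have hb := hanti.tendsto_le_alternating_series ht (k + 1)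
  rw [hsum (2 * k + 1)]
  rw [show 2 * (k + 1) + 1 = 2 * k + 1 + 1 + 1 by ring, Finset.sum_range_succ, Finset.sum_range_succ] at hb
  have e1 : (-1 : ℝ) ^ (2 * k + 1) = -1 := by simp [pow_succ, pow_mul]
  have e2 : (-1 : ℝ) ^ (2 * k + 1 + 1) = 1 := by rw [pow_succ, e1]; norm_num
  rw [e1, e2] at hb
  linarith [hlt (2 * k + 1)]

theorem exists_dk (k : ℕ) (c : ℝ) (hc : c ∈ Set.Ioo 0 (Real.pi / 2))
    (hzero : (∑ i ∈ Finset.range (2 * k + 2), (-1 : ℝ) ^ i * c ^ (2 * i) / (Nat.factorial (2 * i))) = 0) :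
    ∃ d ∈ Set.Ioo c (Real.pi / 2),
      Real.cos d = |∑ i ∈ Finset.range (2 * k + 2), (-1 : ℝ) ^ i * d ^ (2 * i) / (Nat.factorial (2 * i))| := by
  let f : ℝ → ℝ := fun d => Real.cos d -
    |∑ i ∈ Finset.range (2 * k + 2), (-1 : ℝ) ^ i * d ^ (2 * i) / (Nat.factorial (2 * i))|
  have hf : Continuous f := by
    simp only [f]
    fun_prop
  have h1 : 0 < f c := by
    simp only [f, hzero, abs_zero, sub_zero]
    exact Real.cos_pos_of_mem_Ioo ⟨by linarith [hc.1, hc.2], hc.2⟩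
  have h2 : f (Real.pi / 2) < 0 := by
    simp only [f, Real.cos_pi_div_two]
    have := abs_pos.2 (T_lt_zero k).ne
    linarith
  obtain ⟨d, hd, hd0⟩ := intermediate_value_Ioo' hc.2.le hf.continuousOn ⟨h2, h1⟩
  exact ⟨d, hd, sub_eq_zero.1 hd0⟩
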